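/- Let F be holomorphic and zero-free on 𝔻, belonging to the Smirnov class N⁺, so that F* exists and F*(e^{iθ}) ≠ 0 almost everywhere. Write F(z) = ρ(z)e^{iφ(z)} with ρ > 0 continuous and φ a continuous real-valued branch of the argument on 𝔻, and set F_n(z) = ρ(z)^{1/n} e^{iφ(z)/n}. Then for almost every e^{iθ} ∈ 𝕋, F_n(re^{iθ}) → 1 uniformly in r ∈ [0,1) as n → ∞; in particular M(F_n − 1)(θ) → 0 as n → ∞ for almost every θ. -/

import Mathlib

open MeasureTheory Filter Set
open scoped ENNReal Topology Real NNReal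

noncomputable section

/-- The open unit disk in the complex plane. -/
def unitDisk : Set ℂ := Metric.ball 0 1

/-- The point `r·e^{iθ}`. -/
def circlePt (r θ : ℝ) : ℂ := (r : ℂ) * Complex.exp (θ * Complex.I)

/-- The maximal radial function `Mf(θ) = sup_{0 ≤ r < 1} |f(r e^{iθ})|`, valued in `ℝ≥0∞`. -/
def maxRad (f : ℂ → ℂ) (θ : ℝ) : ℝ≥0∞ :=
  ⨆ r ∈ Set.Ico (0 : ℝ) 1, (‖f (circlePt r θ)‖₊ : ℝ≥0∞)

/-- `log⁺` on `ℝ≥0∞`. -/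
def elogPlus (x : ℝ≥0∞) : ℝ≥0∞ :=
  if x = ∞ then ∞ else ENNReal.ofReal (Real.log x.toReal)

/-- `x ↦ log (1 + x)` on `ℝ≥0∞`. -/
def elog1p (x : ℝ≥0∞) : ℝ≥0∞ :=
  if x = ∞ then ∞ else ENNReal.ofReal (Real.log (1 + x.toReal))

/-- The radial boundary value `f*(e^{iθ}) = lim_{r→1⁻} f(r e^{iθ})`
(a junk value is returned where the limit does not exist). -/
def radialLimit (f : ℂ → ℂ) (θ : ℝ) : ℂ :=
  limUnder (nhdsWithin (1 : ℝ) (Set.Iio 1)) fun r : ℝ => f (circlePt r θ)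

/-- The class `M^p`: holomorphic functions on the unit disk with
`∫₀^{2π} (log⁺ Mf(θ))^p dθ/2π < ∞`. -/
def MpClass (p : ℝ) : Set (ℂ → ℂ) :=
  {f | DifferentiableOn ℂ f unitDisk ∧
    (∫⁻ θ in Set.Ioc 0 (2 * π), elogPlus (maxRad f θ) ^ p) / ENNReal.ofReal (2 * π) < ∞}

/-- The metric `ρ_p` on `M^p`. -/
def rhoMetric (p : ℝ) (f g : ℂ → ℂ) : ℝ≥0∞ :=
  ((∫⁻ θ in Set.Ioc 0 (2 * π), elog1p (maxRad (f - g) θ) ^ p) /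
    ENNReal.ofReal (2 * π)) ^ (1 / p)

/-- The Privalov class `N^p`: holomorphic functions on the unit disk with
`sup_{0≤r<1} ∫₀^{2π} (log⁺|f(re^{iθ})|)^p dθ/2π < ∞`. -/
def NpClass (p : ℝ) : Set (ℂ → ℂ) :=
  {f | DifferentiableOn ℂ f unitDisk ∧
    (⨆ r ∈ Set.Ico (0 : ℝ) 1,
      (∫⁻ θ in Set.Ioc 0 (2 * π),
        ENNReal.ofReal (Real.log ‖f (circlePt r θ)‖) ^ p) / ENNReal.ofReal (2 * π)) < ∞}

/-- The metric `d_p` on `N^p`, defined via boundary values. -/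
def dMetric (p : ℝ) (f g : ℂ → ℂ) : ℝ≥0∞ :=
  ((∫⁻ θ in Set.Ioc 0 (2 * π),
      ENNReal.ofReal (Real.log (1 + ‖radialLimit f θ - radialLimit g θ‖)) ^ p) /
    ENNReal.ofReal (2 * π)) ^ (1 / p)

/-- The Hardy space `H^p`. -/
def HpClass (p : ℝ) : Set (ℂ → ℂ) :=
  {f | DifferentiableOn ℂ f unitDisk ∧
    (⨆ r ∈ Set.Ico (0 : ℝ) 1,
      (∫⁻ θ in Set.Ioc 0 (2 * π), (‖f (circlePt r θ)‖₊ : ℝ≥0∞) ^ p) /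
        ENNReal.ofReal (2 * π)) < ∞}

/-- The Smirnov class `N⁺`. -/
def SmirnovClass : Set (ℂ → ℂ) :=
  {f | DifferentiableOn ℂ f unitDisk ∧
    (∫⁻ θ in Set.Ioc 0 (2 * π), ENNReal.ofReal (Real.log ‖radialLimit f θ‖)) /
      ENNReal.ofReal (2 * π) < ∞ ∧
    Tendsto
      (fun r : ℝ => (∫⁻ θ in Set.Ioc 0 (2 * π),
        ENNReal.ofReal (Real.log ‖f (circlePt r θ)‖)) / ENNReal.ofReal (2 * π))
      (nhdsWithin (1 : ℝ) (Set.Iio 1))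
      (nhds ((∫⁻ θ in Set.Ioc 0 (2 * π),
        ENNReal.ofReal (Real.log ‖radialLimit f θ‖)) / ENNReal.ofReal (2 * π)))}

/-- The normalized Blaschke factor `(|a|/a)·(a − z)/(1 − conj a · z)`. -/
def blaschkeFactor (a z : ℂ) : ℂ :=
  ((‖a‖ : ℂ) / a) * ((a - z) / (1 - (starRingEnd ℂ) a * z))

/-- `B` is a (finite or infinite) Blaschke product on the unit disk. -/
def IsBlaschkeProduct (B : ℂ → ℂ) : Prop :=
  ∃ m : ℕ,
    (∃ n : ℕ, ∃ a : ℕ → ℂ, (∀ k < n, a k ∈ unitDisk ∧ a k ≠ 0) ∧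
      ∀ z ∈ unitDisk, B z = z ^ m * ∏ k ∈ Finset.range n, blaschkeFactor (a k) z) ∨
    (∃ a : ℕ → ℂ, (∀ k, a k ∈ unitDisk ∧ a k ≠ 0) ∧ (Summable fun k => 1 - ‖a k‖) ∧
      ∀ z ∈ unitDisk, B z = z ^ m * ∏' k, blaschkeFactor (a k) z)

/-- `I` is an ideal of the ring `M^p`. -/
structure IsIdealIn (p : ℝ) (I : Set (ℂ → ℂ)) : Prop where
  subset : I ⊆ MpClass p
  zero_mem : (0 : ℂ → ℂ) ∈ I
  add_mem : ∀ f ∈ I, ∀ g ∈ I, f + g ∈ I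
  neg_mem : ∀ f ∈ I, -f ∈ I
  mul_mem : ∀ f ∈ MpClass p, ∀ g ∈ I, f * g ∈ I

/-- `I` is a prime ideal of the ring `M^p`: an ideal such that whenever a product of two
elements of `M^p` lies in `I`, one of the factors lies in `I`. -/
def IsPrimeIdealIn (p : ℝ) (I : Set (ℂ → ℂ)) : Prop :=
  IsIdealIn p I ∧ ∀ f ∈ MpClass p, ∀ g ∈ MpClass p, f * g ∈ I → f ∈ I ∨ g ∈ I

/-- `I` is a dense subset of the metric space `(M^p, ρ_p)`. -/
def IsDenseIn (p : ℝ) (I : Set (ℂ → ℂ)) : Prop :=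
  ∀ f ∈ MpClass p, ∀ ε : ℝ≥0∞, 0 < ε → ∃ g ∈ I, rhoMetric p f g < ε

/-- `I` is an ideal of the ring `N^p`. -/
structure IsIdealInNp (p : ℝ) (I : Set (ℂ → ℂ)) : Prop where
  subset : I ⊆ NpClass p
  zero_mem : (0 : ℂ → ℂ) ∈ I
  add_mem : ∀ f ∈ I, ∀ g ∈ I, f + g ∈ I
  neg_mem : ∀ f ∈ I, -f ∈ I
  mul_mem : ∀ f ∈ NpClass p, ∀ g ∈ I, f * g ∈ I

/-- `I` is a prime ideal of the ring `N^p`. -/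
def IsPrimeIdealInNp (p : ℝ) (I : Set (ℂ → ℂ)) : Prop :=
  IsIdealInNp p I ∧ ∀ f ∈ NpClass p, ∀ g ∈ NpClass p, f * g ∈ I → f ∈ I ∨ g ∈ I

/-- `I` is a dense subset of the metric space `(N^p, d_p)`. -/
def IsDenseInNp (p : ℝ) (I : Set (ℂ → ℂ)) : Prop :=
  ∀ f ∈ NpClass p, ∀ ε : ℝ≥0∞, 0 < ε → ∃ g ∈ I, dMetric p f g < ε



/-- Weak-type maximal inequality for a finite measure on the line. -/
lemma weak_type_maximal (ν : Measure ℝ) [IsFiniteMeasure ν] (l : ℝ) (hl : 0 < l) :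
    volume {θ : ℝ | ∃ δ > 0, ENNReal.ofReal (l * δ) < ν (Metric.closedBall θ δ)} ≤
      ENNReal.ofReal (8 / l) * ν univ := by
  classical
  set E : Set ℝ := {θ : ℝ | ∃ δ > 0, ENNReal.ofReal (l * δ) < ν (Metric.closedBall θ δ)} with hE
  have hch : ∀ θ : ℝ, ∃ δ : ℝ, θ ∈ E → 0 < δ ∧
      ENNReal.ofReal (l * δ) < ν (Metric.closedBall θ δ) := by
    intro θ
    by_cases h : θ ∈ E
    · obtain ⟨δ, h1, h2⟩ := h
      exact ⟨δ, fun _ => ⟨h1, h2⟩⟩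
    · exact ⟨0, fun h' => absurd h' h⟩
  choose δ hδ using hch
  have hb : ∀ a ∈ E, δ a ≤ (ν univ).toReal / l := by
    intro a ha
    have h1 : ENNReal.ofReal (l * δ a) ≤ ν univ := (hδ a ha).2.le.trans (measure_mono (subset_univ _))
    rw [ENNReal.ofReal_le_iff_le_toReal (measure_ne_top _ _)] at h1
    rw [le_div_iff₀ hl]
    linarith
  obtain ⟨u, hu, hdisj, hcov⟩ := Vitali.exists_disjoint_subfamily_covering_enlargement_closedBall
    E (fun x => x) δ _ hb 4 (by norm_num)
  have hcount : u.Countable := by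
    apply hdisj.countable_of_nonempty_interior
    intro a ha
    rw [interior_closedBall _ (hδ a (hu ha)).1.ne']
    exact ⟨a, Metric.mem_ball_self (hδ a (hu ha)).1⟩
  have hsub : E ⊆ ⋃ b ∈ u, Metric.closedBall b (4 * δ b) := by
    intro a ha
    obtain ⟨b, hbu, hb2⟩ := hcov a ha
    exact mem_biUnion hbu (hb2 (Metric.mem_closedBall_self (hδ a ha).1.le))
  calc volume E ≤ volume (⋃ b ∈ u, Metric.closedBall b (4 * δ b)) := measure_mono hsub
    _ ≤ ∑' b : u, volume (Metric.closedBall (b : ℝ) (4 * δ b)) := measure_biUnion_le _ hcount _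
    _ ≤ ∑' b : u, ENNReal.ofReal (8 / l) * ν (Metric.closedBall (b : ℝ) (δ b)) := by
        refine ENNReal.tsum_le_tsum fun b => ?_
        have h := hδ b (hu b.2)
        rw [Real.volume_closedBall]
        calc ENNReal.ofReal (2 * (4 * δ b)) = ENNReal.ofReal (8 / l) * ENNReal.ofReal (l * δ b) := by
              rw [← ENNReal.ofReal_mul (by positivity)]
              congr 1
              field_simp
              ring
          _ ≤ _ := by gcongr; exact h.2.le
    _ = ENNReal.ofReal (8 / l) * ν (⋃ b ∈ u, Metric.closedBall b (δ b)) := by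
        rw [ENNReal.tsum_mul_left, measure_biUnion hcount hdisj]
        exact fun b _ => Metric.isClosed_closedBall.measurableSet
    _ ≤ _ := by gcongr; exact subset_univ _

lemma kernel_bound (ν : Measure ℝ) (θ l ε : ℝ) (hl : 0 < l) (hε : 0 < ε)
    (h : ∀ δ > 0, ν (Metric.closedBall θ δ) ≤ ENNReal.ofReal (l * δ)) :
    ∫⁻ t, ENNReal.ofReal (ε / (ε ^ 2 + (t - θ) ^ 2)) ∂ν ≤ ENNReal.ofReal (8 * l) := by
  have hpt : ∀ t : ℝ, ENNReal.ofReal (ε / (ε ^ 2 + (t - θ) ^ 2)) ≤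
      ∑' j : ℕ, (Metric.closedBall θ (2 ^ j * ε)).indicator
        (fun _ => ENNReal.ofReal (4 / 4 ^ j / ε)) t := by
    intro t
    have hex : ∃ j : ℕ, |t - θ| ≤ 2 ^ j * ε := by
      obtain ⟨j, hj⟩ := pow_unbounded_of_one_lt (|t - θ| / ε) (by norm_num : (1 : ℝ) < 2)
      exact ⟨j, by rw [div_lt_iff₀ hε] at hj; exact hj.le⟩
    classical
    set j := Nat.find hex with hj
    have hj1 : |t - θ| ≤ 2 ^ j * ε := Nat.find_spec hex
    refine le_trans ?_ (ENNReal.le_tsum j)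
    rw [indicator_of_mem (by rw [Metric.mem_closedBall, Real.dist_eq]; exact hj1)]
    apply ENNReal.ofReal_le_ofReal
    rcases Nat.eq_zero_or_eq_succ_pred j with h0 | h0
    · rw [h0]
      simp only [pow_zero, div_one]
      rw [div_le_div_iff₀ (by positivity) hε]
      nlinarith [sq_nonneg (t - θ), sq_nonneg ε]
    · set i := j.pred
      have hi : 2 ^ i * ε < |t - θ| := by
        have := Nat.find_min hex (m := i) (by omega)
        exact not_le.mp this
      have hi2 : 4 ^ i * ε ^ 2 ≤ (t - θ) ^ 2 := by
        have h1 : (2 ^ i * ε) ^ 2 ≤ |t - θ| ^ 2 := by gcongr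
        rw [sq_abs, mul_pow, ← pow_mul, mul_comm i 2, pow_mul] at h1
        norm_num at h1
        exact h1
      rw [h0, Nat.succ_eq_add_one, pow_succ (4 : ℝ) i]
      have h4 : (0 : ℝ) < 4 ^ i := by positivity
      rw [div_div, div_le_div_iff₀ (by positivity) (by positivity)]
      nlinarith [sq_nonneg ε]
  calc ∫⁻ t, ENNReal.ofReal (ε / (ε ^ 2 + (t - θ) ^ 2)) ∂ν
      ≤ ∫⁻ t, ∑' j : ℕ, (Metric.closedBall θ (2 ^ j * ε)).indicator
        (fun _ => ENNReal.ofReal (4 / 4 ^ j / ε)) t ∂ν := lintegral_mono hpt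
    _ = ∑' j : ℕ, ENNReal.ofReal (4 / 4 ^ j / ε) * ν (Metric.closedBall θ (2 ^ j * ε)) := by
        rw [lintegral_tsum]
        · congr 1; ext j
          rw [lintegral_indicator Metric.isClosed_closedBall.measurableSet]
          simp
        · intro j
          exact (measurable_const.indicator Metric.isClosed_closedBall.measurableSet).aemeasurable
    _ ≤ ∑' j : ℕ, ENNReal.ofReal (4 * l * (1 / 2) ^ j) := by
        refine ENNReal.tsum_le_tsum fun j => ?_
        calc _ ≤ ENNReal.ofReal (4 / 4 ^ j / ε) * ENNReal.ofReal (l * (2 ^ j * ε)) := by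
              gcongr; exact h _ (by positivity)
          _ = _ := by
              rw [← ENNReal.ofReal_mul (by positivity)]
              congr 1
              have : (4 : ℝ) ^ j = 2 ^ j * 2 ^ j := by rw [← mul_pow]; norm_num
              rw [this, one_div, inv_pow]
              field_simp
    _ = ENNReal.ofReal (8 * l) := by
        rw [← ENNReal.ofReal_tsum_of_nonneg (fun j => by positivity)
          (summable_geometric_two.mul_left _), tsum_mul_left, tsum_geometric_two]
        congr 1; ring

lemma poisson_le (R r θ t : ℝ) (hR : 0 < R) (hr0 : 0 ≤ r) (hr : r < R) (ht : |t - θ| ≤ π) :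
    poissonKernel 0 (circlePt r θ) (circleMap 0 R t) ≤
      40 * ((1 - r / R) / ((1 - r / R) ^ 2 + (t - θ) ^ 2)) := by
  set q := r / R with hq
  have hq0 : 0 ≤ q := by positivity
  have hq1 : q < 1 := by rw [hq, div_lt_one hR]; exact hr
  have hrq : r = q * R := by rw [hq]; field_simp
  have hnz : ‖circlePt r θ‖ = q * R := by
    rw [circlePt, norm_mul, Complex.norm_exp_ofReal_mul_I, mul_one, Complex.norm_real,
      Real.norm_of_nonneg hr0, hrq]
  have hnw : ‖circleMap 0 R t‖ = R := by rw [norm_circleMap_zero, abs_of_pos hR]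
  set s := t - θ with hs
  have hdist : ‖circleMap 0 R t - circlePt r θ‖ = R * ‖(Complex.exp (s * Complex.I) - q)‖ := by
    have h1 : circleMap 0 R t - circlePt r θ =
        R * Complex.exp (θ * Complex.I) * (Complex.exp (s * Complex.I) - q) := by
      rw [circleMap, circlePt, hrq, mul_sub, mul_assoc _ (Complex.exp _) (Complex.exp _),
        ← Complex.exp_add, hs]
      push_cast
      rw [show (θ : ℂ) * Complex.I + (t - θ) * Complex.I = t * Complex.I by ring]
      ring
    rw [h1, norm_mul, norm_mul, Complex.norm_exp_ofReal_mul_I, Complex.norm_real,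
      Real.norm_of_nonneg hR.le, mul_one]
  set D := ‖(Complex.exp (s * Complex.I) - q)‖ with hD
  have hD1 : 1 - q ≤ D := by
    have := norm_sub_norm_le (Complex.exp (s * Complex.I)) (q : ℂ)
    rw [Complex.norm_exp_ofReal_mul_I, Complex.norm_real, Real.norm_of_nonneg hq0] at this
    exact this
  have hD2 : |s| / π ≤ D := by
    have h1 : ‖Complex.exp (s * Complex.I) - 1‖ ≤ D + (1 - q) := by
      have h2 : Complex.exp (s * Complex.I) - 1 =
        (Complex.exp (s * Complex.I) - q) - ((1 - q : ℝ) : ℂ) := by push_cast; ring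
      rw [h2]
      refine (norm_sub_le _ _).trans ?_
      rw [Complex.norm_real, Real.norm_of_nonneg (by linarith)]
    have h3 : ‖Complex.exp (s * Complex.I) - 1‖ = ‖2 * Real.sin (s / 2)‖ := by
      rw [mul_comm, Complex.norm_exp_I_mul_ofReal_sub_one]
    have h4 : 2 / π * |s| ≤ ‖2 * Real.sin (s / 2)‖ := by
      rw [norm_mul, Real.norm_eq_abs, Real.norm_eq_abs, abs_of_pos (by norm_num : (0 : ℝ) < 2)]
      have := Real.mul_abs_le_abs_sin (x := s / 2) (by rw [abs_div, abs_two]; linarith)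
      rw [abs_div, abs_two] at this
      linarith
    have h5 : 2 / π * |s| = 2 * (|s| / π) := by ring
    linarith
  have hD3 : (1 - q) ^ 2 + s ^ 2 ≤ 20 * D ^ 2 := by
    have h1 : (1 - q) ^ 2 ≤ D ^ 2 := pow_le_pow_left₀ (by linarith) hD1 2
    have h2 : |s| ≤ π * D := by rw [div_le_iff₀ Real.pi_pos] at hD2; linarith
    have h3 : s ^ 2 ≤ (π * D) ^ 2 := by
      rw [← sq_abs s]; exact pow_le_pow_left₀ (abs_nonneg _) h2 2
    have h4 : π ^ 2 ≤ 10 := by nlinarith [Real.pi_lt_d2, Real.pi_pos]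
    nlinarith [sq_nonneg D]
  have hDpos : 0 < D := by linarith
  rw [poissonKernel_def]
  simp only [sub_zero]
  rw [hnz, hnw, hdist]
  have he : (R ^ 2 - (q * R) ^ 2) / (R * D) ^ 2 = (1 - q) * (1 + q) / D ^ 2 := by
    field_simp
    ring
  rw [he]
  have hpos : 0 < (1 - q) ^ 2 + s ^ 2 := by
    have : 0 < 1 - q := by linarith
    positivity
  rw [← mul_div_assoc, div_le_div_iff₀ (by positivity) hpos]
  have h1q : 0 < 1 - q := by linarith
  calc (1 - q) * (1 + q) * ((1 - q) ^ 2 + s ^ 2) ≤ (1 - q) * 2 * (20 * D ^ 2) := by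
        gcongr; linarith
    _ = _ := by ring

lemma circlePt_eq (r θ : ℝ) : circlePt r θ = circleMap 0 r θ := by
  simp [circlePt, circleMap]

lemma circlePt_norm (r θ : ℝ) (hr : 0 ≤ r) : ‖circlePt r θ‖ = r := by
  rw [circlePt_eq, norm_circleMap_zero, abs_of_nonneg hr]

lemma lemmaA (K : ℂ → ℂ) (R l : ℝ) (hR : 0 < R) (hl : 0 < l)
    (hK : DiffContOnCl ℂ K (Metric.ball 0 R))
    (hre : ∀ z ∈ Metric.closedBall (0 : ℂ) R, ‖K z‖ ≤ 2 * (K z).re) :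
    volume {θ : ℝ | θ ∈ Ioc 0 (2 * π) ∧ ∃ r ∈ Ico 0 R, 640 * l < ‖K (circlePt r θ)‖} ≤
      ENNReal.ofReal (32 * π * ‖K 0‖ / l) := by
  have hcont : ContinuousOn K (Metric.closedBall 0 R) := hK.continuousOn_ball
  have hmem : ∀ t, circleMap 0 R t ∈ Metric.closedBall (0 : ℂ) R :=
    fun t => circleMap_mem_closedBall 0 hR.le t
  set f : ℝ → ℝ := fun t => (K (circleMap 0 R t)).re with hf
  have hf0 : ∀ t, 0 ≤ f t := fun t => by
    have := (norm_nonneg _).trans (hre _ (hmem t))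
    simp only [hf]; linarith
  have hKc : Continuous fun t => K (circleMap 0 R t) :=
    hcont.comp_continuous (continuous_circleMap 0 R) hmem
  have hfc : Continuous f := Complex.continuous_re.comp hKc
  have hper : Function.Periodic f (2 * π) := fun t => by
    simp only [hf]; rw [periodic_circleMap 0 R t]
  have hpoisc : ∀ w ∈ Metric.ball (0 : ℂ) R,
      Continuous fun t => poissonKernel 0 w (circleMap 0 R t) := by
    intro w hw
    simp only [poissonKernel_def, sub_zero]
    apply Continuous.div (by fun_prop) (by fun_prop)
    intro t
    have : circleMap 0 R t - w ≠ 0 := sub_ne_zero.2 (circleMap_ne_mem_ball hw t)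
    positivity
  have hcircK : ∀ w ∈ Metric.ball (0 : ℂ) R, (K w).re =
      (2 * π)⁻¹ * ∫ t in 0..2 * π, poissonKernel 0 w (circleMap 0 R t) * f t := by
    intro w hw
    have hpc := hpoisc w hw
    have h := hK.circleAverage_poissonKernel_smul hw
    rw [Real.circleAverage_def] at h
    have hc : Continuous fun t => (poissonKernel 0 w • K) (circleMap 0 R t) := hpc.smul hKc
    have h2 := Complex.reCLM.intervalIntegral_comp_comm
      (hc.intervalIntegrable (μ := volume) 0 (2 * π))
    conv_lhs => rw [← h]
    rw [Complex.real_smul, Complex.re_ofReal_mul]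
    congr 1
    rw [Complex.reCLM_apply] at h2
    rw [← h2]
    congr 1
    ext t
    simp [hf]
  have hint : ∫ t in (0)..2 * π, f t = 2 * π * (K 0).re := by
    have h := hcircK 0 (Metric.mem_ball_self hR)
    have h1 : ∀ t, poissonKernel 0 0 (circleMap 0 R t) = 1 := by
      intro t
      rw [poissonKernel_def]
      simp [abs_of_pos hR, hR.ne']
    simp only [h1, one_mul] at h
    rw [h]
    field_simp
  set ν : Measure ℝ := (volume.restrict (Ioc (-π) (3 * π))).withDensity
    (fun t => ENNReal.ofReal (f t)) with hν
  have hνuniv : ν univ = ENNReal.ofReal (4 * π * (K 0).re) := by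
    rw [hν, withDensity_apply _ MeasurableSet.univ, Measure.restrict_univ,
      ← ofReal_integral_eq_lintegral_ofReal]
    · congr 1
      rw [← intervalIntegral.integral_of_le (by linarith [Real.pi_pos]),
        ← intervalIntegral.integral_add_adjacent_intervals (b := π)
          (hfc.intervalIntegrable _ _) (hfc.intervalIntegrable _ _)]
      have h1 := hper.intervalIntegral_add_eq (-π) 0
      have h2 := hper.intervalIntegral_add_eq π 0
      rw [show -π + 2 * π = π by ring, zero_add, hint] at h1
      rw [show π + 2 * π = 3 * π by ring, zero_add, hint] at h2
      rw [h1, h2]; ring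
    · exact (hfc.integrableOn_Icc (a := -π) (b := 3 * π)).mono_set Ioc_subset_Icc_self
    · exact ae_of_all _ hf0
  have : IsFiniteMeasure ν := ⟨by rw [hνuniv]; exact ENNReal.ofReal_lt_top⟩
  have hmain := weak_type_maximal ν l hl
  have hsub : {θ : ℝ | θ ∈ Ioc 0 (2 * π) ∧ ∃ r ∈ Ico 0 R, 640 * l < ‖K (circlePt r θ)‖} ⊆
      {θ : ℝ | ∃ δ > 0, ENNReal.ofReal (l * δ) < ν (Metric.closedBall θ δ)} := by
    rintro θ ⟨hθ, r, ⟨hr0, hr⟩, hbig⟩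
    by_contra hcon
    simp only [mem_ofPred_eq, not_exists, not_and, not_lt] at hcon
    have hε : 0 < 1 - r / R := by
      have : r / R < 1 := by rw [div_lt_one hR]; exact hr
      linarith
    have hk := kernel_bound ν θ l (1 - r / R) hl hε (fun δ hδ => hcon δ hδ)
    have hzb : circlePt r θ ∈ Metric.ball (0 : ℂ) R := by
      rw [mem_ball_zero_iff, circlePt_norm r θ hr0]; exact hr
    set k : ℝ → ℝ := fun t => (1 - r / R) / ((1 - r / R) ^ 2 + (t - θ) ^ 2) with hkdef
    have hkc : Continuous k := by
      apply Continuous.div (by fun_prop) (by fun_prop)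
      intro t; positivity
    have hk0 : ∀ t, 0 ≤ k t := fun t => by simp only [hkdef]; positivity
    have hpc := hpoisc _ hzb
    have hshift : ∫ t in 0..2 * π, poissonKernel 0 (circlePt r θ) (circleMap 0 R t) * f t =
        ∫ t in (θ - π)..(θ + π), poissonKernel 0 (circlePt r θ) (circleMap 0 R t) * f t := by
      have hper2 : Function.Periodic
          (fun t => poissonKernel 0 (circlePt r θ) (circleMap 0 R t) * f t) (2 * π) := by
        intro t
        simp only [hf]
        rw [periodic_circleMap 0 R t]
      have := hper2.intervalIntegral_add_eq 0 (θ - π)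
      rw [zero_add, show θ - π + 2 * π = θ + π by ring] at this
      exact this
    have hle : ∫ t in (θ - π)..(θ + π), poissonKernel 0 (circlePt r θ) (circleMap 0 R t) * f t ≤
        ∫ t in (θ - π)..(θ + π), 40 * (k t * f t) := by
      apply intervalIntegral.integral_mono_on (by linarith [Real.pi_pos])
      · exact (hpc.mul hfc).intervalIntegrable _ _
      · exact (continuous_const.mul (hkc.mul hfc)).intervalIntegrable _ _
      · intro t ht
        rw [← mul_assoc]
        apply mul_le_mul_of_nonneg_right _ (hf0 t)
        exact poisson_le R r θ t hR hr0 hr (by rw [abs_le]; constructor <;> linarith [ht.1, ht.2])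
    have hbound : ∫ t in (θ - π)..(θ + π), k t * f t ≤ 8 * l := by
      have hkf : Continuous fun t => k t * f t := hkc.mul hfc
      rw [← ENNReal.ofReal_le_ofReal_iff (by positivity)]
      refine le_trans ?_ hk
      rw [intervalIntegral.integral_of_le (by linarith [Real.pi_pos]),
        ofReal_integral_eq_lintegral_ofReal
          ((hkf.integrableOn_Icc (a := θ - π) (b := θ + π)).mono_set Ioc_subset_Icc_self)
          (ae_of_all _ fun t => mul_nonneg (hk0 t) (hf0 t)), hν,
        lintegral_withDensity_eq_lintegral_mul _ (by fun_prop) (by fun_prop)]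
      calc ∫⁻ t in Ioc (θ - π) (θ + π), ENNReal.ofReal (k t * f t)
          ≤ ∫⁻ t in Ioc (-π) (3 * π), ENNReal.ofReal (k t * f t) := by
            apply lintegral_mono_set
            apply Ioc_subset_Ioc <;> linarith [hθ.1, hθ.2]
        _ ≤ _ := by
            apply lintegral_mono
            intro t
            simp only [Pi.mul_apply]
            rw [mul_comm, ENNReal.ofReal_mul (hf0 t)]
    have hfin : (K (circlePt r θ)).re ≤ 320 * l := by
      rw [hcircK _ hzb, hshift]
      rw [intervalIntegral.integral_const_mul] at hle
      have hpi : (2 * π)⁻¹ ≤ 1 := inv_le_one_of_one_le₀ (by linarith [Real.pi_gt_three])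
      calc _ ≤ (2 * π)⁻¹ * (320 * l) := by gcongr; linarith
        _ ≤ 1 * (320 * l) := by gcongr
        _ = _ := one_mul _
    have := hre _ (Metric.ball_subset_closedBall hzb)
    linarith
  refine (measure_mono hsub).trans (hmain.trans ?_)
  rw [hνuniv, ← ENNReal.ofReal_mul (by positivity)]
  apply ENNReal.ofReal_le_ofReal
  have := Complex.re_le_norm (K 0)
  rw [show 8 / l * (4 * π * (K 0).re) = 32 * π * (K 0).re / l by ring]
  gcongr

lemma sqrt_bound (w : ℂ) (hw : 0 < w.re) :
    ‖w ^ (1 / 2 : ℂ)‖ ≤ 2 * (w ^ (1 / 2 : ℂ)).re ∧ ‖w ^ (1 / 2 : ℂ)‖ ^ 2 = ‖w‖ := by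
  have hw0 : w ≠ 0 := by rintro rfl; simp at hw
  set v := w ^ (1 / 2 : ℂ) with hv
  have hsq : v ^ 2 = w := by
    rw [hv, ← Complex.cpow_mul_nat]; simp
  have hre : 0 ≤ v.re := by
    rw [hv, Complex.cpow_def_of_ne_zero hw0, Complex.exp_re]
    apply mul_nonneg (Real.exp_pos _).le
    apply Real.cos_nonneg_of_mem_Icc
    have h1 := Complex.neg_pi_lt_arg w
    have h2 := Complex.arg_le_pi w
    have h3 : (Complex.log w * (1 / 2)).im = w.arg / 2 := by
      rw [show (1 / 2 : ℂ) = ((1 / 2 : ℝ) : ℂ) by push_cast; rfl, Complex.im_mul_ofReal,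
        Complex.log_im]
      ring
    rw [h3]
    constructor <;> linarith
  constructor
  · have h1 : v.re ^ 2 - v.im ^ 2 > 0 := by
      rw [← hsq, sq, Complex.mul_re] at hw
      nlinarith
    have h2 : ‖v‖ ^ 2 = v.re ^ 2 + v.im ^ 2 := by
      rw [Complex.sq_norm, Complex.normSq_apply]; ring
    rw [← pow_le_pow_iff_left₀ (norm_nonneg _) (by positivity) two_ne_zero]
    nlinarith
  · rw [← norm_pow, hsq]

lemma lemmaB (G : ℂ → ℂ) (R R' l C : ℝ) (hR' : 0 < R') (hRR : R' < R) (hl : 0 < l) (hC : 0 ≤ C)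
    (hG : DifferentiableOn ℂ G (Metric.ball 0 R))
    (hre : ∀ z ∈ Metric.ball (0 : ℂ) R, 0 ≤ (G z).re) (h0 : ‖G 0‖ ≤ C) :
    volume {θ : ℝ | θ ∈ Ioc 0 (2 * π) ∧ ∃ r ∈ Ico 0 R',
        (640 * l) ^ 2 + 1 < ‖G (circlePt r θ)‖} ≤
      ENNReal.ofReal (32 * π * (1 + C) / l) := by
  set K : ℂ → ℂ := fun z => (1 + G z) ^ (1 / 2 : ℂ) with hK
  have hpos : ∀ z ∈ Metric.ball (0 : ℂ) R, 0 < (1 + G z).re := by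
    intro z hz
    have := hre z hz
    simp; linarith
  have hKd : DifferentiableOn ℂ K (Metric.ball 0 R) := by
    apply DifferentiableOn.cpow (by fun_prop) (by fun_prop)
    intro z hz
    exact Or.inl (hpos z hz)
  have hsub : Metric.closedBall (0 : ℂ) R' ⊆ Metric.ball 0 R := Metric.closedBall_subset_ball hRR
  have hKc : DiffContOnCl ℂ K (Metric.ball 0 R') := by
    apply DifferentiableOn.diffContOnCl
    rw [closure_ball _ hR'.ne']
    exact hKd.mono hsub
  have hA := lemmaA K R' l hR' hl hKc (fun z hz => (sqrt_bound _ (hpos z (hsub hz))).1)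
  refine (measure_mono ?_).trans (hA.trans ?_)
  · rintro θ ⟨hθ, r, hr, hbig⟩
    refine ⟨hθ, r, hr, ?_⟩
    have hz : circlePt r θ ∈ Metric.ball (0 : ℂ) R := by
      rw [mem_ball_zero_iff, circlePt_norm r θ hr.1]; exact hr.2.trans hRR
    have h2 := (sqrt_bound _ (hpos _ hz)).2
    apply lt_of_pow_lt_pow_left₀ 2 (norm_nonneg _)
    simp only [hK]
    rw [h2]
    have h3 : ‖G (circlePt r θ)‖ ≤ ‖1 + G (circlePt r θ)‖ + 1 := by
      have := norm_sub_le (1 + G (circlePt r θ)) 1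
      rw [add_sub_cancel_left, norm_one] at this
      exact this
    linarith
  · apply ENNReal.ofReal_le_ofReal
    have h1 : ‖K 0‖ ≤ 1 + C := by
      have h2 := (sqrt_bound _ (hpos 0 (Metric.mem_ball_self (hR'.trans hRR)))).2
      have h3 : ‖1 + G 0‖ ≤ 1 + C := (norm_add_le _ _).trans (by rw [norm_one]; linarith)
      rw [← pow_le_pow_iff_left₀ (norm_nonneg _) (by positivity) two_ne_zero]
      simp only [hK]
      rw [h2]
      nlinarith
    gcongr

lemma lemmaC1 (g : ℂ → ℂ) (R R' l C : ℝ) (hR' : 0 < R') (hRR : R' < R) (hl : 0 < l) (hC : 0 ≤ C)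
    (hg : DiffContOnCl ℂ g (Metric.ball 0 R))
    (hav : Real.circleAverage (fun z => max (g z).re 0) 0 R ≤ C) :
    volume {θ : ℝ | θ ∈ Ioc 0 (2 * π) ∧ ∃ r ∈ Ico 0 R',
        2 * ((640 * l) ^ 2 + 1) < ‖g (circlePt r θ)‖} ≤
      ENNReal.ofReal (64 * π * (1 + C + ‖g 0‖) / l) := by
  have hR : 0 < R := hR'.trans hRR
  set u : ℂ → ℝ := fun z => max (g z).re 0 with hu
  have hsph : Metric.sphere (0 : ℂ) |R| ⊆ Metric.closedBall 0 R := by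
    rw [abs_of_pos hR]; exact Metric.sphere_subset_closedBall
  have hgc : ContinuousOn g (Metric.sphere (0 : ℂ) |R|) := hg.continuousOn_ball.mono hsph
  have hgre : ContinuousOn (fun z => (g z).re) (Metric.sphere (0 : ℂ) |R|) :=
    Complex.continuous_re.comp_continuousOn hgc
  have huc : ContinuousOn u (Metric.sphere (0 : ℂ) |R|) := hgre.sup continuousOn_const
  have hui : CircleIntegrable u 0 R := huc.circleIntegrable'
  have hui' : CircleIntegrable (fun z => (u z : ℂ)) 0 R :=
    (Complex.continuous_ofReal.comp_continuousOn huc).circleIntegrable'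
  set G : ℂ → ℂ := fun w => Real.circleAverage
    (fun ζ => herglotzRieszKernel 0 w ζ • (u ζ : ℂ)) 0 R with hG
  have hGd : DifferentiableOn ℂ G (Metric.ball 0 R) :=
    differentiableOn_circleAverage_herglotzRieszKernel_smul hui'
  have hkc : ∀ w ∈ Metric.ball (0 : ℂ) R,
      ContinuousOn (Complex.re ∘ herglotzRieszKernel 0 w) (Metric.sphere (0 : ℂ) |R|) :=
    fun w hw => Complex.continuous_re.comp_continuousOn (continuousOn_herglotzRieszKernel_sphere hw)
  have hk0 : ∀ w ∈ Metric.ball (0 : ℂ) R, ∀ ζ ∈ Metric.sphere (0 : ℂ) |R|,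
      0 ≤ (Complex.re ∘ herglotzRieszKernel 0 w) ζ := by
    intro w hw ζ hζ
    rw [abs_of_pos hR] at hζ
    refine le_trans ?_ (le_re_herglotzRieszKernel hζ hw)
    rw [mem_ball_iff_norm] at hw
    apply div_nonneg
    · linarith
    · positivity
  have hGre : ∀ w ∈ Metric.ball (0 : ℂ) R, (G w).re =
      Real.circleAverage ((Complex.re ∘ herglotzRieszKernel 0 w) • u) 0 R :=
    fun w hw => re_circleAverage_herglotzRieszKernel_smul hui hw
  have hgP : ∀ w ∈ Metric.ball (0 : ℂ) R, (g w).re =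
      Real.circleAverage ((Complex.re ∘ herglotzRieszKernel 0 w) • (fun z => (g z).re)) 0 R := by
    intro w hw
    have h := hg.circleAverage_re_herglotzRieszKernel_smul hw
    have h2 := Complex.reCLM.circleAverage_comp_comm (f := (Complex.re ∘ herglotzRieszKernel 0 w) • g)
      (c := 0) (R := R) (((hkc w hw).smul hgc).circleIntegrable')
    rw [h] at h2
    rw [← Complex.reCLM_apply, ← h2]
    congr 1
    ext z
    simp
  have hG0 : ∀ w ∈ Metric.ball (0 : ℂ) R, 0 ≤ (G w).re := by
    intro w hw
    rw [hGre w hw]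
    apply Real.circleAverage_nonneg_of_nonneg
    intro ζ hζ
    exact mul_nonneg (hk0 w hw ζ hζ) (le_max_right _ _)
  have hGg : ∀ w ∈ Metric.ball (0 : ℂ) R, 0 ≤ (G w - g w).re := by
    intro w hw
    rw [Complex.sub_re, hGre w hw, hgP w hw, sub_nonneg]
    apply Real.circleAverage_mono
    · exact ((hkc w hw).smul hgre).circleIntegrable'
    · exact ((hkc w hw).smul huc).circleIntegrable'
    · intro ζ hζ
      exact mul_le_mul_of_nonneg_left (le_max_left _ _) (hk0 w hw ζ hζ)
  have hGz : ‖G 0‖ ≤ C := by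
    have h1 : G 0 = ((Real.circleAverage u 0 R : ℝ) : ℂ) := by
      have h2 := Complex.ofRealCLM.circleAverage_comp_comm hui
      rw [Complex.ofRealCLM_apply] at h2
      rw [← h2, hG]
      apply Real.circleAverage_congr_sphere
      intro ζ hζ
      have hζ0 : ζ ≠ 0 := by
        rintro rfl
        simp at hζ
        exact hR.ne' (abs_eq_zero.1 hζ.symm)
      simp [herglotzRieszKernel_def, hζ0]
    rw [h1, Complex.norm_real, Real.norm_of_nonneg]
    · exact hav
    · exact Real.circleAverage_nonneg_of_nonneg fun _ _ => le_max_right _ _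
  have hB1 := lemmaB G R R' l (C + ‖g 0‖) hR' hRR hl (by positivity) hGd hG0
    (hGz.trans (by linarith [norm_nonneg (g 0)]))
  have hB2 := lemmaB (fun z => G z - g z) R R' l (C + ‖g 0‖) hR' hRR hl (by positivity)
    (hGd.sub hg.differentiableOn) hGg ((norm_sub_le _ _).trans (by linarith))
  have hsub : {θ : ℝ | θ ∈ Ioc 0 (2 * π) ∧ ∃ r ∈ Ico 0 R',
        2 * ((640 * l) ^ 2 + 1) < ‖g (circlePt r θ)‖} ⊆
      {θ : ℝ | θ ∈ Ioc 0 (2 * π) ∧ ∃ r ∈ Ico 0 R', (640 * l) ^ 2 + 1 < ‖G (circlePt r θ)‖} ∪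
      {θ : ℝ | θ ∈ Ioc 0 (2 * π) ∧ ∃ r ∈ Ico 0 R',
        (640 * l) ^ 2 + 1 < ‖G (circlePt r θ) - g (circlePt r θ)‖} := by
    rintro θ ⟨hθ, r, hr, hbig⟩
    by_cases h : (640 * l) ^ 2 + 1 < ‖G (circlePt r θ)‖
    · exact Or.inl ⟨hθ, r, hr, h⟩
    · refine Or.inr ⟨hθ, r, hr, ?_⟩
      have := norm_sub_le (G (circlePt r θ)) (G (circlePt r θ) - g (circlePt r θ))
      rw [sub_sub_cancel] at this
      linarith
  refine (measure_mono hsub).trans ((measure_union_le _ _).trans ((add_le_add hB1 hB2).trans ?_))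
  rw [← ENNReal.ofReal_add (by positivity) (by positivity)]
  apply ENNReal.ofReal_le_ofReal
  apply le_of_eq
  ring

lemma lemmaC (g : ℂ → ℂ) (C : ℝ) (hC : 0 ≤ C)
    (hg : DifferentiableOn ℂ g (Metric.ball 0 1))
    (hav : ∀ᶠ R in 𝓝[<] (1 : ℝ), Real.circleAverage (fun z => max (g z).re 0) 0 R ≤ C) :
    ∀ᵐ θ ∂(volume.restrict (Set.Ioc 0 (2 * π))),
      ∃ B : ℝ, ∀ r ∈ Ico (0 : ℝ) 1, ‖g (circlePt r θ)‖ ≤ B := by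
  have hS : ∀ l : ℝ, 0 < l → volume {θ : ℝ | θ ∈ Ioc 0 (2 * π) ∧ ∃ r ∈ Ico 0 1,
        2 * ((640 * l) ^ 2 + 1) < ‖g (circlePt r θ)‖} ≤
      ENNReal.ofReal (64 * π * (1 + C + ‖g 0‖) / l) := by
    intro l hl
    have hU : {θ : ℝ | θ ∈ Ioc 0 (2 * π) ∧ ∃ r ∈ Ico 0 1,
        2 * ((640 * l) ^ 2 + 1) < ‖g (circlePt r θ)‖} =
        ⋃ n : ℕ, {θ : ℝ | θ ∈ Ioc 0 (2 * π) ∧ ∃ r ∈ Ico 0 (1 - 1 / ((n : ℝ) + 2)),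
        2 * ((640 * l) ^ 2 + 1) < ‖g (circlePt r θ)‖} := by
      ext θ
      simp only [mem_iUnion]
      constructor
      · rintro ⟨hθ, r, hr, hb⟩
        obtain ⟨n, hn⟩ := exists_nat_gt (1 / (1 - r))
        refine ⟨n, hθ, r, ⟨hr.1, ?_⟩, hb⟩
        have h1 : 0 < 1 - r := by linarith [hr.2]
        rw [div_lt_iff₀ h1] at hn
        have h2 : 1 / ((n : ℝ) + 2) < 1 - r := by
          rw [div_lt_iff₀ (by positivity)]
          nlinarith
        linarith
      · rintro ⟨n, hθ, r, hr, hb⟩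
        refine ⟨hθ, r, ⟨hr.1, hr.2.trans ?_⟩, hb⟩
        have : (0 : ℝ) < 1 / ((n : ℝ) + 2) := by positivity
        linarith
    have hmono : Monotone fun n : ℕ => {θ : ℝ | θ ∈ Ioc 0 (2 * π) ∧
        ∃ r ∈ Ico 0 (1 - 1 / ((n : ℝ) + 2)),
        2 * ((640 * l) ^ 2 + 1) < ‖g (circlePt r θ)‖} := by
      rintro m n hmn θ ⟨hθ, r, hr, hb⟩
      refine ⟨hθ, r, ⟨hr.1, hr.2.trans_le ?_⟩, hb⟩
      gcongr
    rw [hU, hmono.measure_iUnion]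
    apply iSup_le
    intro n
    have hn1 : 1 - 1 / ((n : ℝ) + 2) < 1 := by
      have : (0 : ℝ) < 1 / ((n : ℝ) + 2) := by positivity
      linarith
    have hn0 : 0 < 1 - 1 / ((n : ℝ) + 2) := by
      rw [sub_pos, div_lt_one (by positivity)]
      linarith [Nat.cast_nonneg (α := ℝ) n]
    obtain ⟨R, hRC, hR⟩ := (hav.and (Ioo_mem_nhdsLT hn1)).exists
    have hR0 : 0 < R := hn0.trans hR.1
    refine lemmaC1 g R _ l C hn0 hR.1 hl hC ?_ hRC
    apply DifferentiableOn.diffContOnCl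
    rw [closure_ball _ hR0.ne']
    exact hg.mono (Metric.closedBall_subset_ball hR.2)
  rw [ae_restrict_iff' measurableSet_Ioc, ae_iff]
  have hle : ∀ l : ℝ, 0 < l → volume {θ : ℝ | ¬(θ ∈ Ioc 0 (2 * π) →
      ∃ B : ℝ, ∀ r ∈ Ico (0 : ℝ) 1, ‖g (circlePt r θ)‖ ≤ B)} ≤
      ENNReal.ofReal (64 * π * (1 + C + ‖g 0‖) / l) := by
    intro l hl
    refine (measure_mono ?_).trans (hS l hl)
    intro θ hθ
    simp only [mem_ofPred_eq] at hθ
    push Not at hθ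
    exact ⟨hθ.1, hθ.2 _⟩
  apply le_antisymm _ zero_le
  have hlim : Tendsto (fun l : ℝ => ENNReal.ofReal (64 * π * (1 + C + ‖g 0‖) / l)) atTop (𝓝 0) := by
    rw [← ENNReal.ofReal_zero]
    exact (ENNReal.continuous_ofReal.tendsto 0).comp (tendsto_const_nhds.div_atTop tendsto_id)
  refine ge_of_tendsto hlim ?_
  filter_upwards [eventually_gt_atTop 0] with l hl using hle l hl

lemma log_differentiable (F g : ℂ → ℂ) (hF : DifferentiableOn ℂ F (Metric.ball 0 1))
    (hg : ContinuousOn g (Metric.ball 0 1))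
    (hexp : ∀ z ∈ Metric.ball (0 : ℂ) 1, F z = Complex.exp (g z)) :
    DifferentiableOn ℂ g (Metric.ball 0 1) := by
  intro z hz
  have hnhds : Metric.ball (0 : ℂ) 1 ∈ 𝓝 z := Metric.isOpen_ball.mem_nhds hz
  have hFz : DifferentiableAt ℂ F z := hF.differentiableAt hnhds
  have hgz : ContinuousAt g z := hg.continuousAt hnhds
  apply DifferentiableAt.differentiableWithinAt
  have hd : DifferentiableAt ℂ (fun w => g z + Complex.log (F w * Complex.exp (-g z))) z := by
    apply DifferentiableAt.const_add
    apply DifferentiableAt.clog (hFz.mul_const _)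
    rw [hexp z hz, ← Complex.exp_add, add_neg_cancel, Complex.exp_zero]
    exact Complex.one_mem_slitPlane
  refine hd.congr_of_eventuallyEq ?_
  have hnear : ∀ᶠ w in 𝓝 z, ‖g w - g z‖ < 1 := by
    have := Metric.continuousAt_iff'.1 hgz 1 one_pos
    simpa [dist_eq_norm] using this
  filter_upwards [hnear, hnhds] with w hw hwb
  have him : |(g w - g z).im| < 1 := (Complex.abs_im_le_norm _).trans_lt hw
  rw [abs_lt] at him
  rw [hexp w hwb, ← Complex.exp_add, ← sub_eq_add_neg, Complex.log_exp]
  · ring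
  · linarith [Real.pi_gt_three]
  · linarith [Real.pi_gt_three]

/-- Let `F` be zero-free, holomorphic on the disk and in the Smirnov class,
written as `F = ρ·e^{iφ}` with `ρ > 0` and `φ` continuous real-valued, and let
`F_n = ρ^{1/n}·e^{iφ/n}`. Then for almost every `θ`, `F_n(r e^{iθ}) → 1` uniformly in
`r ∈ [0,1)` as `n → ∞`; in particular `M(F_n − 1)(θ) → 0` for almost every `θ`. -/
theorem roots_tendsto_one_ae (F : ℂ → ℂ)
    (hF : F ∈ SmirnovClass) (hnz : ∀ z ∈ unitDisk, F z ≠ 0)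
    (ρ : ℂ → ℝ) (φ : ℂ → ℝ)
    (hρ : ContinuousOn ρ unitDisk) (hφ : ContinuousOn φ unitDisk)
    (hρpos : ∀ z ∈ unitDisk, 0 < ρ z)
    (hfac : ∀ z ∈ unitDisk, F z = (ρ z : ℂ) * Complex.exp ((φ z : ℂ) * Complex.I))
    (Fn : ℕ → ℂ → ℂ)
    (hFn : ∀ n : ℕ, 1 ≤ n → ∀ z ∈ unitDisk,
      Fn n z = ((ρ z ^ ((n : ℝ)⁻¹) : ℝ) : ℂ) * Complex.exp (((φ z / n : ℝ) : ℂ) * Complex.I)) :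
    ∀ᵐ θ ∂(volume.restrict (Set.Ioc 0 (2 * π))),
      TendstoUniformlyOn (fun n (r : ℝ) => Fn n (circlePt r θ)) (fun _ => 1) atTop
        (Set.Ico (0 : ℝ) 1) ∧
      Tendsto (fun n => maxRad (Fn n - 1) θ) atTop (nhds 0) := by
  obtain ⟨hFd, hfin, htend⟩ := hF
  set g : ℂ → ℂ := fun z => (Real.log (ρ z) : ℂ) + (φ z : ℂ) * Complex.I with hg
  have hgre : ∀ z, (g z).re = Real.log (ρ z) := fun z => by
    simp [hg, -Complex.ofReal_log]
  have hgc : ContinuousOn g unitDisk := by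
    have h1 : ContinuousOn (fun z => Real.log (ρ z)) unitDisk :=
      hρ.log fun z hz => (hρpos z hz).ne'
    exact (Complex.continuous_ofReal.comp_continuousOn h1).add
      ((Complex.continuous_ofReal.comp_continuousOn hφ).mul continuousOn_const)
  have hexp : ∀ z ∈ unitDisk, F z = Complex.exp (g z) := by
    intro z hz
    rw [hfac z hz, hg]
    simp only
    rw [Complex.exp_add, ← Complex.ofReal_exp, Real.exp_log (hρpos z hz)]
  have hnorm : ∀ z ∈ unitDisk, Real.log ‖F z‖ = (g z).re := by
    intro z hz
    rw [hexp z hz, Complex.norm_exp, Real.log_exp]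
  have hgd : DifferentiableOn ℂ g (Metric.ball 0 1) := log_differentiable F g hFd hgc hexp
  set L := (∫⁻ θ in Set.Ioc 0 (2 * π), ENNReal.ofReal (Real.log ‖radialLimit F θ‖)) /
      ENNReal.ofReal (2 * π) with hL
  have hpos : (0 : ℝ) < 2 * π := by positivity
  have hav : ∀ᶠ R in 𝓝[<] (1 : ℝ),
      Real.circleAverage (fun z => max (g z).re 0) 0 R ≤ (L + 1).toReal := by
    have hL1 : L + 1 ≠ ∞ := ENNReal.add_ne_top.2 ⟨hfin.ne, ENNReal.one_ne_top⟩
    have hev := htend.eventually_lt_const (ENNReal.lt_add_right hfin.ne one_ne_zero)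
    filter_upwards [hev, Ioo_mem_nhdsLT (zero_lt_one' ℝ)] with R hR hR01
    have hmem : ∀ t, circleMap 0 R t ∈ unitDisk := by
      intro t
      rw [unitDisk, mem_ball_zero_iff, norm_circleMap_zero, abs_of_pos hR01.1]
      exact hR01.2
    have hcont : Continuous fun t => max (g (circleMap 0 R t)).re 0 :=
      (Complex.continuous_re.comp (hgc.comp_continuous (continuous_circleMap 0 R) hmem)).max
        continuous_const
    rw [← ENNReal.ofReal_le_iff_le_toReal hL1]
    refine le_trans (le_of_eq ?_) hR.le
    rw [Real.circleAverage_def, smul_eq_mul, mul_comm, ← div_eq_mul_inv,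
      ENNReal.ofReal_div_of_pos hpos]
    congr 1
    rw [intervalIntegral.integral_of_le hpos.le, ofReal_integral_eq_lintegral_ofReal]
    · apply lintegral_congr
      intro t
      rw [circlePt_eq, hnorm _ (hmem t), ENNReal.ofReal_max, ENNReal.ofReal_zero]
      simp
    · exact (hcont.integrableOn_Icc (a := 0) (b := 2 * π)).mono_set Ioc_subset_Icc_self
    · exact ae_of_all _ fun t => le_max_right _ _
  have hae := lemmaC g _ ENNReal.toReal_nonneg hgd hav
  filter_upwards [hae] with θ hθ
  obtain ⟨B, hB⟩ := hθ
  have hB0 : 0 ≤ B := (norm_nonneg _).trans (hB 0 (by simp))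
  have hFnexp : ∀ n : ℕ, 1 ≤ n → ∀ z ∈ unitDisk, Fn n z = Complex.exp (g z / n) := by
    intro n hn z hz
    rw [hFn n hn z hz, Real.rpow_def_of_pos (hρpos z hz), Complex.ofReal_exp, ← Complex.exp_add, hg]
    congr 1
    push_cast
    ring
  have hkey : ∀ n : ℕ, 1 ≤ n → B ≤ n → ∀ r ∈ Ico (0 : ℝ) 1,
      ‖Fn n (circlePt r θ) - 1‖ ≤ 2 * B / n := by
    intro n hn hBn r hr
    have hn0 : (0 : ℝ) < n := by exact_mod_cast hn
    have hz : circlePt r θ ∈ unitDisk := by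
      rw [unitDisk, mem_ball_zero_iff, circlePt_norm r θ hr.1]; exact hr.2
    rw [hFnexp n hn _ hz]
    have h1 : ‖g (circlePt r θ) / n‖ ≤ B / n := by
      rw [norm_div, Complex.norm_natCast]
      gcongr
      exact hB r hr
    have h2 : B / n ≤ 1 := by rw [div_le_one hn0]; exact hBn
    have h3 := Complex.norm_exp_sub_one_le (h1.trans h2)
    calc _ ≤ _ := h3
      _ ≤ 2 * (B / n) := by gcongr
      _ = _ := by ring
  have hlim : Tendsto (fun n : ℕ => 2 * B / (n : ℝ)) atTop (𝓝 0) :=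
    tendsto_const_div_atTop_nhds_zero_nat _
  have hlarge : ∀ᶠ n : ℕ in atTop, 1 ≤ n ∧ B ≤ n :=
    (eventually_ge_atTop 1).and (tendsto_natCast_atTop_atTop.eventually_ge_atTop B)
  constructor
  · rw [Metric.tendstoUniformlyOn_iff]
    intro ε hε
    filter_upwards [hlarge, hlim.eventually_lt_const hε] with n hn hnε r hr
    rw [dist_comm, dist_eq_norm]
    exact (hkey n hn.1 hn.2 r hr).trans_lt hnε
  · have hlim2 : Tendsto (fun n : ℕ => ENNReal.ofReal (2 * B / (n : ℝ))) atTop (𝓝 0) := by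
      rw [← ENNReal.ofReal_zero]
      exact (ENNReal.continuous_ofReal.tendsto 0).comp hlim
    refine tendsto_of_tendsto_of_tendsto_of_le_of_le' tendsto_const_nhds hlim2
      (Eventually.of_forall fun _ => zero_le) ?_
    filter_upwards [hlarge] with n hn
    refine iSup₂_le fun r hr => ?_
    rw [← enorm_eq_nnnorm, ← ofReal_norm]
    exact ENNReal.ofReal_le_ofReal (hkey n hn.1 hn.2 r hr)
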